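/- The infimum over all 2π-periodic H¹ functions u on (-π,π) with ∫u = 0, ∫u cos θ = 0, ∫u sin θ = 0 (u not identically zero) of the quotient (∫(u')² - u²)/(∫|u|)² equals 1/(2(4-π)). -/

import Mathlib

open Real MeasureTheory

theorem hasDerivAt_max_zero_of_pos {w : ℝ → ℝ} {d x : ℝ} (hw : HasDerivAt w d x) (hx : 0 < w x) :
    HasDerivAt (fun t => max (w t) 0) d x := by
  refine hw.congr_of_eventuallyEq ?_
  filter_upwards [hw.continuousAt.eventually (lt_mem_nhds hx)] with t ht
  exact max_eq_left ht.le

theorem absolutelyContinuousOnInterval_max_zero {w w' : ℝ → ℝ}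
    (hw : ∀ x, HasDerivAt w (w' x) x) (hw' : Continuous w') (l r : ℝ) :
    AbsolutelyContinuousOnInterval (fun t => max (w t) 0) l r := by
  have hC : ContDiff ℝ 1 w := by
    rw [contDiff_one_iff_deriv]
    refine ⟨fun x => (hw x).differentiableAt, ?_⟩
    rwa [show deriv w = w' from funext fun x => (hw x).deriv]
  obtain ⟨K, hK⟩ := hC.contDiffOn.exists_lipschitzOnWith one_ne_zero (convex_uIcc l r)
    isCompact_uIcc
  exact ((LipschitzWith.id.max_const 0).comp_lipschitzOnWith hK).absolutelyContinuousOnInterval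

theorem intervalIntegrable_indicator_one {S : Set ℝ} (hS : MeasurableSet S) (a b : ℝ) :
    IntervalIntegrable (S.indicator (fun _ => (1 : ℝ))) volume a b := by
  rw [intervalIntegrable_iff]
  exact (integrableOn_const (by simp)).indicator hS

/-- The calibration argument bounding the energy on a set where `w ≥ 0`. -/
theorem calibration {w w' : ℝ → ℝ} {S : Set ℝ} (hw : ∀ x, HasDerivAt w (w' x) x)
    (hw' : Continuous w') (hS : MeasurableSet S) (hpos : ∀ x, 0 < w x → x ∈ S)
    (hnonneg : ∀ x ∈ S, 0 ≤ w x) {y : ℝ → ℝ} {a l r α : ℝ} (c : ℝ) (hlr : l ≤ r)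
    (hy : ∀ x, y x = (∫ s in a..x, S.indicator (fun _ => (1 : ℝ)) s) + α)
    (hyl : -(π / 2) < y l) (hyr : y r < π / 2) :
    (c ^ 2 * y r - (c + max (w r) 0) ^ 2 * tan (y r)) -
      (c ^ 2 * y l - (c + max (w l) 0) ^ 2 * tan (y l)) ≤
    (∫ x in l..r, S.indicator (fun x => w' x ^ 2 - w x ^ 2) x) -
      2 * c * ∫ x in l..r, max (w x) 0 := by
  have hwc : Continuous w := continuous_iff_continuousAt.2 fun x => (hw x).continuousAt
  have hχ := intervalIntegrable_indicator_one hS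
  have hsub : ∀ x x', y x' - y x = ∫ s in x..x', S.indicator (fun _ => (1 : ℝ)) s := by
    intro x x'
    rw [hy, hy, ← intervalIntegral.integral_add_adjacent_intervals (hχ a x) (hχ x x')]
    ring
  have hmono : Monotone y := by
    intro x x' hx
    rw [← sub_nonneg, hsub]
    exact intervalIntegral.integral_nonneg hx fun u _ => Set.indicator_nonneg (by simp) u
  have hyI : ∀ x ∈ Set.uIcc l r, y x ∈ Set.Icc (y l) (y r) := by
    intro x hx
    rw [Set.uIcc_of_le hlr] at hx
    exact ⟨hmono hx.1, hmono hx.2⟩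
  have hcos : ∀ t ∈ Set.Icc (y l) (y r), cos t ≠ 0 := fun t ht =>
    (cos_pos_of_mem_Ioo ⟨hyl.trans_le ht.1, ht.2.trans_lt hyr⟩).ne'
  have hylip : LipschitzOnWith 1 y (Set.uIcc l r) := by
    refine LipschitzOnWith.of_dist_le_mul fun x _ x' _ => ?_
    rw [dist_comm, Real.dist_eq, hsub, dist_comm, Real.dist_eq]
    have := intervalIntegral.norm_integral_le_of_norm_le_const (a := x) (b := x') (C := 1)
      (f := S.indicator (fun _ => (1 : ℝ))) (fun u _ => by
        by_cases hu : u ∈ S <;> simp [hu])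
    simpa using this
  obtain ⟨K, hK⟩ := ContDiffOn.exists_lipschitzOnWith (n := 1) (f := tan)
    (s := Set.Icc (y l) (y r)) (fun t ht =>
      (contDiffAt_tan.2 (hcos t ht)).contDiffWithinAt) one_ne_zero (convex_Icc _ _) isCompact_Icc
  have hτ : AbsolutelyContinuousOnInterval (fun x => tan (y x)) l r :=
    (hK.comp hylip hyI).absolutelyContinuousOnInterval
  have hyac := hylip.absolutelyContinuousOnInterval
  have hm := absolutelyContinuousOnInterval_max_zero hw hw' l r
  have hcm : AbsolutelyContinuousOnInterval (fun x => c + max (w x) 0) l r :=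
    ((LipschitzWith.const c).lipschitzOnWith (s := Set.uIcc l r)).absolutelyContinuousOnInterval.add hm
  have hH : AbsolutelyContinuousOnInterval
      (fun x => c ^ 2 * y x - (c + max (w x) 0) ^ 2 * tan (y x)) l r := by
    have h2 : AbsolutelyContinuousOnInterval
      (fun x => c ^ 2 * y x - ((c + max (w x) 0) * (c + max (w x) 0)) * tan (y x)) l r :=
      (hyac.const_mul (c ^ 2)).sub ((hcm.mul hcm).mul hτ)
    simpa only [pow_two] using h2
  have hE : IntervalIntegrable (S.indicator (fun x => w' x ^ 2 - w x ^ 2)) volume l r := by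
    have : IntervalIntegrable (fun x => w' x ^ 2 - w x ^ 2) volume l r :=
      Continuous.intervalIntegrable (by fun_prop) _ _
    rw [intervalIntegrable_iff] at this ⊢
    exact this.indicator hS
  have hM : IntervalIntegrable (fun x => 2 * c * max (w x) 0) volume l r :=
    Continuous.intervalIntegrable (by fun_prop) _ _
  rw [← intervalIntegral.integral_const_mul, ← intervalIntegral.integral_sub hE hM]
  rw [← hH.integral_deriv_eq_sub]
  refine intervalIntegral.integral_mono_ae_restrict hlr hH.intervalIntegrable_deriv (hE.sub hM) ?_
  rw [Filter.EventuallyLE, ae_restrict_iff' measurableSet_Icc]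
  filter_upwards [hm.ae_differentiableAt, (hχ l r).ae_hasDerivAt_integral] with x hx1 hx2 hx
  rw [← Set.uIcc_of_le hlr] at hx
  have hdm := (hx1 hx).hasDerivAt
  have hdy : HasDerivAt y (S.indicator (fun _ => (1 : ℝ)) x) x := by
    have h := (hx2 hx l Set.left_mem_uIcc).add_const (y l)
    refine h.congr_of_eventuallyEq (Filter.Eventually.of_forall fun t => ?_)
    simp [← hsub]
  have hcx := hcos _ (hyI x hx)
  have hdτ := (hasDerivAt_tan hcx).comp x hdy
  have hdH := (hdy.const_mul (c ^ 2)).sub (((hdm.const_add c).pow 2).mul hdτ)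
  have hdH' : deriv (fun x => c ^ 2 * y x - (c + max (w x) 0) ^ 2 * tan (y x)) x = _ := hdH.deriv
  rw [hdH']
  have hsec : 1 / cos (y x) ^ 2 = 1 + tan (y x) ^ 2 := by
    rw [tan_eq_sin_div_cos]
    field_simp
    linarith [sin_sq_add_cos_sq (y x)]
  simp only [Function.comp, hsec, Pi.pow_apply]
  by_cases hwx : 0 < w x
  · have hxS := hpos x hwx
    rw [(hasDerivAt_max_zero_of_pos (hw x) hwx).deriv]
    simp only [Set.indicator_of_mem hxS, max_eq_left hwx.le]
    simp
    nlinarith [sq_nonneg (w' x + (c + w x) * tan (y x))]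
  · have hwx' := not_lt.1 hwx
    have h0 : deriv (fun t => max (w t) 0) x = 0 := by
      refine IsLocalMin.deriv_eq_zero (Filter.Eventually.of_forall fun t => ?_)
      simp [hwx']
    rw [h0]
    by_cases hxS : x ∈ S
    · have hz : w x = 0 := le_antisymm hwx' (hnonneg x hxS)
      simp only [Set.indicator_of_mem hxS, hz, max_self]
      simp
      nlinarith [sq_nonneg (w' x), sq_nonneg (c * tan (y x))]
    · simp [Set.indicator_of_notMem hxS, hwx']

/-- The energy of the nonnegative part of a `π`-periodic function, supported on a set of
measure `p`. -/
theorem one_sided_energy {w w' : ℝ → ℝ} {S : Set ℝ} (hw : ∀ x, HasDerivAt w (w' x) x)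
    (hw' : Continuous w') (hS : MeasurableSet S) (hpos : ∀ x, 0 < w x → x ∈ S)
    (hnonneg : ∀ x ∈ S, 0 ≤ w x) {l z p : ℝ} (hz : z ∈ Set.Icc l (l + π)) (hwz : w z = 0)
    (hper : w (l + π) = w l)
    (hp : ∫ x in l..(l + π), S.indicator (fun _ => (1 : ℝ)) x = p) (hpπ : p < π) (c : ℝ) :
    2 * c * (∫ x in l..(l + π), max (w x) 0) - c ^ 2 * (2 * (tan (p / 2) - p / 2)) ≤
      ∫ x in l..(l + π), S.indicator (fun x => w' x ^ 2 - w x ^ 2) x := by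
  have hwc : Continuous w := continuous_iff_continuousAt.2 fun x => (hw x).continuousAt
  have hχ := intervalIntegrable_indicator_one hS
  set q : ℝ → ℝ := fun x => ∫ s in l..x, S.indicator (fun _ => (1 : ℝ)) s with hq
  have hql : q l = 0 := by simp [hq]
  have hqr : q (l + π) = p := hp
  have hE : ∀ a b, IntervalIntegrable (S.indicator (fun x => w' x ^ 2 - w x ^ 2)) volume a b := by
    intro a b
    have : IntervalIntegrable (fun x => w' x ^ 2 - w x ^ 2) volume a b :=
      Continuous.intervalIntegrable (by fun_prop) _ _
    rw [intervalIntegrable_iff] at this ⊢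
    exact this.indicator hS
  have hM : ∀ a b, IntervalIntegrable (fun x => max (w x) 0) volume a b := fun a b =>
    Continuous.intervalIntegrable (by fun_prop) _ _
  have hind : ∀ u, 0 ≤ S.indicator (fun _ => (1 : ℝ)) u :=
    fun u => Set.indicator_nonneg (by simp) u
  have hqz : 0 ≤ q z := intervalIntegral.integral_nonneg hz.1 fun u _ => hind u
  have hqz' : q z ≤ p := by
    rw [← hp, ← intervalIntegral.integral_add_adjacent_intervals (hχ l z) (hχ z (l + π))]
    exact le_add_of_nonneg_right (intervalIntegral.integral_nonneg hz.2 fun u _ => hind u)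
  have h1 := calibration hw hw' hS hpos hnonneg (a := l) (α := p / 2 - q z)
    (y := fun x => q x + (p / 2 - q z)) c hz.1 (fun x => rfl)
    (by simp only [hql]; linarith) (by linarith)
  have h2 := calibration hw hw' hS hpos hnonneg (a := l) (α := -(p / 2) - q z)
    (y := fun x => q x + (-(p / 2) - q z)) c hz.2 (fun x => rfl)
    (by linarith) (by simp only [hqr]; linarith)
  rw [← intervalIntegral.integral_add_adjacent_intervals (hE l z) (hE z (l + π)),
    ← intervalIntegral.integral_add_adjacent_intervals (hM l z) (hM z (l + π))]
  simp only [hql, hqr, hwz, hper, max_self] at h1 h2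
  rw [show q z + (p / 2 - q z) = p / 2 by ring, show 0 + (p / 2 - q z) = p / 2 - q z by ring] at h1
  rw [show q z + (-(p / 2) - q z) = -(p / 2) by ring,
    show p + (-(p / 2) - q z) = p / 2 - q z by ring, tan_neg] at h2
  linarith

theorem mul_tan_le_mul_tan {x y : ℝ} (hx : 0 < x) (hxy : x ≤ y) (hy : y < π / 2) :
    y * tan x ≤ x * tan y := by
  have hcos : ∀ t ∈ Set.Icc x y, 0 < cos t := fun t ht =>
    cos_pos_of_mem_Ioo ⟨by linarith [ht.1, pi_pos], by linarith [ht.2]⟩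
  have hd : ∀ t ∈ Set.Icc x y, HasDerivAt (fun t => x * tan t - t * tan x)
      (x * (1 / cos t ^ 2) - 1 * tan x) t := fun t ht =>
    ((hasDerivAt_tan (hcos t ht).ne').const_mul x).sub ((hasDerivAt_id t).mul_const (tan x))
  have hmono : MonotoneOn (fun t => x * tan t - t * tan x) (Set.Icc x y) := by
    refine monotoneOn_of_hasDerivWithinAt_nonneg (convex_Icc _ _)
      (fun t ht => (hd t ht).continuousAt.continuousWithinAt)
      (fun t ht => (hd t (interior_subset ht)).hasDerivWithinAt) fun t ht => ?_
    have ht := interior_subset ht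
    have hc := hcos t ht
    have hcx := hcos x ⟨le_rfl, hxy⟩
    have hct : cos t ≤ cos x := cos_le_cos_of_nonneg_of_le_pi hx.le (by linarith [ht.2]) ht.1
    have h1 : 1 / cos x ^ 2 ≤ 1 / cos t ^ 2 := by gcongr
    have h2 : tan x ≤ x * (1 / cos x ^ 2) := by
      rw [tan_eq_sin_div_cos, mul_one_div, div_le_div_iff₀ hcx (by positivity)]
      have : sin x * cos x ≤ x := by
        have := sin_le hx.le
        have := cos_le_one x
        have : 0 < sin x := sin_pos_of_pos_of_lt_pi hx (by linarith)
        nlinarith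
      nlinarith
    have h3 := mul_le_mul_of_nonneg_left h1 hx.le
    linarith
  have := hmono (Set.left_mem_Icc.2 hxy) (Set.right_mem_Icc.2 hxy) hxy
  simp only at this
  linarith

theorem convexOn_inv_tan_sub : ConvexOn ℝ (Set.Ioo 0 (π / 2)) fun x => (tan x - x)⁻¹ := by
  have hpos : ∀ x ∈ Set.Ioo 0 (π / 2), 0 < tan x - x := fun x hx => sub_pos.2 (lt_tan hx.1 hx.2)
  have hd : ∀ x ∈ Set.Ioo 0 (π / 2),
      HasDerivAt (fun x => (tan x - x)⁻¹) (-(tan x / (tan x - x)) ^ 2) x := by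
    intro x hx
    have hc : 0 < cos x := cos_pos_of_mem_Ioo ⟨by linarith [hx.1, pi_pos], hx.2⟩
    refine (((hasDerivAt_tan hc.ne').sub (hasDerivAt_id x)).inv (hpos x hx).ne').congr_deriv ?_
    have hsec : 1 / cos x ^ 2 = 1 + tan x ^ 2 := by
      rw [tan_eq_sin_div_cos]
      field_simp
      linarith [sin_sq_add_cos_sq x]
    rw [hsec, div_pow]
    simp [neg_div]
  refine MonotoneOn.convexOn_of_deriv (convex_Ioo _ _)
    (fun x hx => (hd x hx).continuousAt.continuousWithinAt)
    (fun x hx => (hd x (interior_subset hx)).differentiableAt.differentiableWithinAt) ?_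
  rw [interior_Ioo]
  intro x hx y hy hxy
  rw [(hd x hx).deriv, (hd y hy).deriv]
  have hty : 0 < tan y := tan_pos_of_pos_of_lt_pi_div_two hy.1 hy.2
  have h1 := hpos x hx
  have h2 := hpos y hy
  have : tan y / (tan y - y) ≤ tan x / (tan x - x) := by
    rw [div_le_div_iff₀ h2 h1]
    linarith [mul_tan_le_mul_tan hx.1 hxy hy.2]
  have h0 : 0 ≤ tan y / (tan y - y) := by positivity
  nlinarith

theorem inv_tan_sub_add_inv_tan_sub_le {x y : ℝ} (hx : 0 < x) (hy : 0 < y) (hxy : x + y = π / 2) :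
    8 / (4 - π) ≤ (tan x - x)⁻¹ + (tan y - y)⁻¹ := by
  obtain ⟨-, h⟩ := convexOn_inv_tan_sub
  replace h := @h x ⟨hx, by linarith⟩ y ⟨hy, by linarith⟩ (1 / 2) (1 / 2) (by norm_num)
    (by norm_num) (by norm_num)
  simp only [smul_eq_mul] at h
  rw [show 1 / 2 * x + 1 / 2 * y = π / 4 by linarith, tan_pi_div_four] at h
  have : 8 / (4 - π) = 2 * (1 - π / 4)⁻¹ := by
    have : 4 - π ≠ 0 := by linarith [pi_lt_four]
    have : 1 - π / 4 ≠ 0 := by linarith [pi_lt_four]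
    field_simp
    ring
  linarith

theorem sq_integral_abs_le_of_half_period {w w' : ℝ → ℝ} (hw : ∀ x, HasDerivAt w (w' x) x)
    (hw' : Continuous w') {l : ℝ} (hper : w (l + π) = w l)
    (hmean : ∫ x in l..(l + π), w x = 0) :
    (∫ x in l..(l + π), |w x|) ^ 2 ≤
      (4 - π) * ∫ x in l..(l + π), (w' x ^ 2 - w x ^ 2) := by
  have hwc : Continuous w := continuous_iff_continuousAt.2 fun x => (hw x).continuousAt
  have hlr : l < l + π := by linarith [pi_pos]
  have h4 : 0 < 4 - π := by linarith [pi_lt_four]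
  obtain ⟨z, hz, hwz⟩ : ∃ z ∈ Set.Ioo l (l + π), w z = 0 :=
    exists_hasDerivAt_eq_zero (f := fun x => ∫ s in l..x, w s) hlr
      (intervalIntegral.continuous_primitive
        (fun a b => hwc.intervalIntegrable a b) l).continuousOn
      (by simp [hmean]) fun x _ => hwc.integral_hasStrictDerivAt l x |>.hasDerivAt
  have hM : ∀ v : ℝ → ℝ, Continuous v → IntervalIntegrable v volume l (l + π) := fun v hv =>
    hv.intervalIntegrable _ _
  set M := ∫ x in l..(l + π), max (w x) 0 with hMdef
  have hM' : ∫ x in l..(l + π), max (-w x) 0 = M := by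
    rw [eq_comm, ← sub_eq_zero, hMdef, ← intervalIntegral.integral_sub (hM _ (by fun_prop))
      (hM _ (by fun_prop))]
    refine (intervalIntegral.integral_congr fun x _ => ?_).trans hmean
    rcases le_total (w x) 0 with h | h <;> simp [h]
  have habs : ∫ x in l..(l + π), |w x| = 2 * M := by
    rw [two_mul]
    nth_rewrite 2 [← hM']
    rw [hMdef, ← intervalIntegral.integral_add (hM _ (by fun_prop)) (hM _ (by fun_prop))]
    refine intervalIntegral.integral_congr fun x _ => ?_
    rcases le_total (w x) 0 with h | h <;> simp [h, abs_of_nonneg, abs_of_nonpos]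
  have hM0 : 0 ≤ M := intervalIntegral.integral_nonneg hlr.le fun x _ => le_max_right _ _
  rcases hM0.eq_or_lt with hM0 | hM0
  · have hzero : ∀ x ∈ Set.Icc l (l + π), w x = 0 := by
      by_contra! hne
      obtain ⟨x, hx, hwx⟩ := hne
      have := intervalIntegral.integral_pos hlr (f := fun x => |w x|) (by fun_prop)
        (fun x _ => abs_nonneg _) ⟨x, hx, abs_pos.2 hwx⟩
      linarith
    rw [habs, ← hM0]
    have : 0 ≤ ∫ x in l..(l + π), (w' x ^ 2 - w x ^ 2) := by
      refine intervalIntegral.integral_nonneg hlr.le fun x hx => ?_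
      rw [hzero x hx]
      nlinarith [sq_nonneg (w' x)]
    nlinarith [mul_nonneg h4.le this]
  have hS : MeasurableSet {x | 0 < w x} := measurableSet_lt measurable_const hwc.measurable
  set S := {x | 0 < w x} with hSdef
  set p := ∫ x in l..(l + π), S.indicator (fun _ => (1 : ℝ)) x with hp
  set n := ∫ x in l..(l + π), Sᶜ.indicator (fun _ => (1 : ℝ)) x with hn
  have hpn : p + n = π := by
    rw [hp, hn, ← intervalIntegral.integral_add (intervalIntegrable_indicator_one hS _ _)
      (intervalIntegrable_indicator_one hS.compl _ _)]
    simp_rw [← Pi.add_apply (S.indicator (fun _ => (1 : ℝ))), Set.indicator_self_add_compl]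
    simp
  have hp0 : 0 ≤ p := intervalIntegral.integral_nonneg hlr.le fun u _ =>
    Set.indicator_nonneg (by simp) u
  have hn0 : 0 ≤ n := intervalIntegral.integral_nonneg hlr.le fun u _ =>
    Set.indicator_nonneg (by simp) u
  have hEint : ∀ T : Set ℝ, MeasurableSet T →
      IntervalIntegrable (T.indicator (fun x => w' x ^ 2 - w x ^ 2)) volume l (l + π) := by
    intro T hT
    have := hM (fun x => w' x ^ 2 - w x ^ 2) (by fun_prop)
    rw [intervalIntegrable_iff] at this ⊢
    exact this.indicator hT
  have hzI := Set.Ioo_subset_Icc_self hz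
  have hP := fun hlt => one_sided_energy hw hw' hS (fun x hx => hx) (fun x hx => le_of_lt hx) hzI
    hwz hper hp.symm hlt
  have hN := fun hlt => one_sided_energy (w := fun x => -w x) (fun x => (hw x).neg) hw'.neg hS.compl
    (fun x hx => by simp only [hSdef, Set.mem_compl_iff, Set.mem_ofPred_eq]; linarith)
    (fun x hx => by simpa [hSdef] using hx) hzI (by simpa using hwz) (by simpa using hper)
    hn.symm hlt
  simp only [neg_sq, hM', ← hMdef] at hP hN
  set E₁ := ∫ x in l..(l + π), S.indicator (fun x => w' x ^ 2 - w x ^ 2) x with hE1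
  set E₂ := ∫ x in l..(l + π), Sᶜ.indicator (fun x => w' x ^ 2 - w x ^ 2) x with hE2
  have hE : ∫ x in l..(l + π), (w' x ^ 2 - w x ^ 2) = E₁ + E₂ := by
    rw [hE1, hE2, ← intervalIntegral.integral_add (hEint S hS) (hEint _ hS.compl)]
    simp_rw [← Pi.add_apply (S.indicator (fun x => w' x ^ 2 - w x ^ 2)),
      Set.indicator_self_add_compl]
  have hoptimize : ∀ t E : ℝ, 0 ≤ t → t < π →
      (∀ c : ℝ, 2 * c * M - c ^ 2 * (2 * (tan (t / 2) - t / 2)) ≤ E) →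
      0 < t ∧ M ^ 2 / 2 * (tan (t / 2) - t / 2)⁻¹ ≤ E := by
    intro t E ht htπ h
    have ht' : 0 < t := by
      refine lt_of_le_of_ne ht fun h0 => ?_
      have := h ((E + 1) / (2 * M))
      rw [← h0] at this
      have h1 : 2 * ((E + 1) / (2 * M)) * M = E + 1 := by field_simp
      rw [h1] at this
      simp at this
      linarith
    refine ⟨ht', ?_⟩
    have hτ : 0 < tan (t / 2) - t / 2 := sub_pos.2 (lt_tan (by linarith) (by linarith))
    convert h (M / (2 * (tan (t / 2) - t / 2))) using 1
    field_simp
    ring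
  have hpos : 0 < p ∧ 0 < n := by
    rcases hp0.eq_or_lt with h | h
    · exact absurd (hoptimize p E₁ hp0 (by linarith [pi_pos]) (hP (by linarith [pi_pos]))).1
        (by linarith)
    · exact ⟨h, (hoptimize n E₂ hn0 (by linarith) (hN (by linarith))).1⟩
  have h1 := (hoptimize p E₁ hp0 (by linarith) (hP (by linarith))).2
  have h2 := (hoptimize n E₂ hn0 (by linarith) (hN (by linarith))).2
  have h3 := inv_tan_sub_add_inv_tan_sub_le (x := p / 2) (y := n / 2) (by linarith) (by linarith)
    (by linarith)
  have h5 : M ^ 2 / 2 * (8 / (4 - π)) ≤ E₁ + E₂ := by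
    have := mul_le_mul_of_nonneg_left h3 (by positivity : 0 ≤ M ^ 2 / 2)
    linarith
  have h6 := mul_le_mul_of_nonneg_left h5 h4.le
  rw [hE, habs]
  have h7 : (4 - π) * (M ^ 2 / 2 * (8 / (4 - π))) = (2 * M) ^ 2 := by
    field_simp
    ring
  linarith

/-- Adding suitable first harmonics to `u` makes both half-period pieces cut at `t` periodic with
mean zero, without changing the energy. -/
theorem sq_integral_abs_add_harmonic_le {u u' : ℝ → ℝ} (hu : ∀ x, HasDerivAt u (u' x) x)
    (hu' : Continuous u') (hper : Function.Periodic u (2 * π)) {t A B : ℝ}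
    (hmean : ∫ x in t..(t + 2 * π), u x = 0) (hA : 2 * A = u (t + π) - u t)
    (hB : 2 * B = -∫ x in t..(t + π), u x) :
    (∫ x in t..(t + 2 * π), |u x + (A * cos (x - t) + B * sin (x - t))|) ^ 2 ≤
      2 * (4 - π) * ∫ x in t..(t + 2 * π), (u' x ^ 2 - u x ^ 2) := by
  have huc : Continuous u := continuous_iff_continuousAt.2 fun x => (hu x).continuousAt
  set h : ℝ → ℝ := fun x => A * cos (x - t) + B * sin (x - t) with hh
  set h' : ℝ → ℝ := fun x => B * cos (x - t) - A * sin (x - t) with hh'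
  have hhc : Continuous h := by fun_prop
  have hhc' : Continuous h' := by fun_prop
  have hdh : ∀ x, HasDerivAt h (h' x) x := by
    intro x
    have hs : HasDerivAt (fun x => x - t) 1 x := (hasDerivAt_id x).sub_const t
    refine ((hs.cos.const_mul A).add (hs.sin.const_mul B)).congr_deriv ?_
    simp only [hh']
    ring
  have hdh' : ∀ x, HasDerivAt h' (-h x) x := by
    intro x
    have hs : HasDerivAt (fun x => x - t) 1 x := (hasDerivAt_id x).sub_const t
    refine ((hs.cos.const_mul B).sub (hs.sin.const_mul A)).congr_deriv ?_
    simp only [hh]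
    ring
  have hI : ∀ {f : ℝ → ℝ}, Continuous f → ∀ a b, IntervalIntegrable f volume a b :=
    fun hf a b => hf.intervalIntegrable a b
  have hsplit : ∀ {f : ℝ → ℝ}, Continuous f → ∫ x in t..(t + 2 * π), f x =
      (∫ x in t..(t + π), f x) + ∫ x in (t + π)..(t + π + π), f x := by
    intro f hf
    rw [intervalIntegral.integral_add_adjacent_intervals (hI hf _ _) (hI hf _ _)]
    congr 1
    ring
  have hu2 : u (t + π + π) = u t := by
    rw [show t + π + π = t + 2 * π by ring, hper]
  have hint : ∀ a b, ∫ x in a..b, h x = -(h' b - h' a) := by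
    intro a b
    rw [← intervalIntegral.integral_eq_sub_of_hasDerivAt (fun x _ => hdh' x)
      (hI hhc.neg _ _), intervalIntegral.integral_neg, neg_neg]
  have e0 : t - t = 0 := sub_self t
  have e1 : t + π - t = π := by ring
  have e2 : t + π + π - t = 2 * π := by ring
  have e3 : t + 2 * π - t = 2 * π := by ring
  have hd : ∀ x, HasDerivAt (fun x => u x + h x) (u' x + h' x) x := fun x => (hu x).add (hdh x)
  have h1 := sq_integral_abs_le_of_half_period hd (hu'.add hhc') (l := t)
    (by simp [hh]; linarith)
    (by
      rw [intervalIntegral.integral_add (hI huc _ _) (hI hhc _ _), hint]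
      simp [hh']
      linarith)
  have h2 := sq_integral_abs_le_of_half_period hd (hu'.add hhc') (l := t + π)
    (by simp [hh, hu2, e2]; linarith)
    (by
      rw [hsplit huc] at hmean
      rw [intervalIntegral.integral_add (hI huc _ _) (hI hhc _ _), hint]
      simp [hh', e2]
      linarith)
  have hQ : ∫ x in t..(t + 2 * π), ((u' x + h' x) ^ 2 - (u x + h x) ^ 2) =
      ∫ x in t..(t + 2 * π), (u' x ^ 2 - u x ^ 2) := by
    have hb := intervalIntegral.integral_eq_sub_of_hasDerivAt (a := t) (b := t + 2 * π)
      (f := fun x => 2 * u x * h' x + h x * h' x)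
      (f' := fun x => (2 * u' x * h' x + 2 * u x * (-h x)) + (h' x * h' x + h x * (-h x)))
      (fun x _ => (((hu x).const_mul 2).mul (hdh' x)).add ((hdh x).mul (hdh' x)))
      (hI (by fun_prop) _ _)
    rw [← sub_eq_zero, ← intervalIntegral.integral_sub (hI (by fun_prop) _ _)
      (hI (by fun_prop) _ _)]
    refine (intervalIntegral.integral_congr fun x _ => ?_).trans (hb.trans ?_)
    · ring
    · simp [hh, hh', hper t]
  rw [hsplit (by fun_prop), ← hQ, hsplit (by fun_prop)]
  nlinarith [sq_nonneg ((∫ x in t..(t + π), |u x + h x|) -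
    ∫ x in (t + π)..(t + π + π), |u x + h x|)]

theorem sq_integral_abs_le_of_period {u u' : ℝ → ℝ} (hu : ∀ x, HasDerivAt u (u' x) x)
    (hu' : Continuous u') (hper : Function.Periodic u (2 * π))
    (hmean : ∫ x in (-π)..π, u x = 0) (hcos : ∫ x in (-π)..π, u x * cos x = 0)
    (hsin : ∫ x in (-π)..π, u x * sin x = 0) :
    (∫ x in (-π)..π, |u x|) ^ 2 ≤ 2 * (4 - π) * ∫ x in (-π)..π, (u' x ^ 2 - u x ^ 2) := by
  have huc : Continuous u := continuous_iff_continuousAt.2 fun x => (hu x).continuousAt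
  have hper' : Function.Periodic u' (2 * π) := by
    intro x
    have h := (hu (x + 2 * π)).comp_add_const x (2 * π)
    exact ((hu x).unique (h.congr_of_eventuallyEq
      (Filter.Eventually.of_forall fun y => (hper y).symm))).symm
  have hshift : ∀ {f : ℝ → ℝ}, Function.Periodic f (2 * π) → ∀ t,
      ∫ x in t..(t + 2 * π), f x = ∫ x in (-π)..π, f x := by
    intro f hf t
    rw [hf.intervalIntegral_add_eq t (-π)]
    congr 1
    ring
  have hI : ∀ {f : ℝ → ℝ}, Continuous f → ∀ a b, IntervalIntegrable f volume a b :=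
    fun hf a b => hf.intervalIntegrable a b
  have hππ : -π ≤ π := by linarith [pi_pos]
  have hshiftπ : ∀ {f : ℝ → ℝ}, Function.Periodic f (2 * π) →
      ∫ x in (-π)..π, f (x + π) = ∫ x in (-π)..π, f x := by
    intro f hf
    rw [intervalIntegral.integral_comp_add_right, ← hshift hf (-π + π)]
    congr 1
    ring
  set Q := ∫ x in (-π)..π, (u' x ^ 2 - u x ^ 2) with hQ
  set U : ℝ → ℝ := fun t => ∫ x in t..(t + π), u x with hU
  have hQper : Function.Periodic (fun x => u' x ^ 2 - u x ^ 2) (2 * π) := fun x => by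
    simp only [hper x, hper' x]
  have hv : ∀ t, (∫ x in (-π)..π, |u x + ((u (t + π) - u t) / 2 * cos (x - t) +
      -U t / 2 * sin (x - t))|) ^ 2 ≤ 2 * (4 - π) * Q := by
    intro t
    have h := sq_integral_abs_add_harmonic_le hu hu' hper (t := t) (A := (u (t + π) - u t) / 2)
      (B := -U t / 2) ((hshift hper t).trans hmean) (by ring) (by ring)
    rw [hshift hQper] at h
    rwa [hshift] at h
    intro x
    simp only [hper x, show x + 2 * π - t = x - t + 2 * π by ring, cos_add_two_pi, sin_add_two_pi]
  have hQ0 : 0 ≤ 2 * (4 - π) * Q := (sq_nonneg _).trans (hv 0)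
  set I := ∫ x in (-π)..π, |u x| with hIdef
  set s : ℝ → ℝ := fun x => if 0 < u x then 1 else -1 with hs
  have hsm : Measurable s :=
    Measurable.ite (measurableSet_lt measurable_const huc.measurable) measurable_const
      measurable_const
  have hsI : ∀ {f : ℝ → ℝ}, Continuous f → IntervalIntegrable (fun x => s x * f x) volume (-π) π := by
    intro f hf
    refine (hI hf (-π) π).mono_fun (hsm.aestronglyMeasurable.mul hf.aestronglyMeasurable)
      (Filter.Eventually.of_forall fun x => ?_)
    by_cases hx : 0 < u x <;> simp [hs, hx]
  set C := ∫ x in (-π)..π, s x * cos x with hC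
  set S := ∫ x in (-π)..π, s x * sin x with hS
  have hle : ∀ t, I + ((u (t + π) - u t) / 2 * (C * cos t + S * sin t) +
      -U t / 2 * (S * cos t - C * sin t)) ≤ √(2 * (4 - π) * Q) := by
    intro t
    refine le_trans ?_ (le_sqrt_of_sq_le (hv t))
    set a := (u (t + π) - u t) / 2
    set b := -U t / 2
    have heq : I + (a * (C * cos t + S * sin t) + b * (S * cos t - C * sin t)) =
        ∫ x in (-π)..π, (s x * u x + ((a * cos t - b * sin t) * (s x * cos x) +
          (a * sin t + b * cos t) * (s x * sin x))) := by
      rw [intervalIntegral.integral_add (hsI huc) (((hsI continuous_cos).const_mul _).add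
        ((hsI continuous_sin).const_mul _)),
        intervalIntegral.integral_add ((hsI continuous_cos).const_mul _)
        ((hsI continuous_sin).const_mul _), intervalIntegral.integral_const_mul,
        intervalIntegral.integral_const_mul, ← hC, ← hS, hIdef]
      have : ∫ x in (-π)..π, |u x| = ∫ x in (-π)..π, s x * u x := by
        refine intervalIntegral.integral_congr fun x _ => ?_
        by_cases hx : 0 < u x
        · simp [hs, hx, abs_of_pos]
        · simp [hs, hx, abs_of_nonpos (not_lt.1 hx)]
      rw [this]
      ring
    rw [heq]
    refine intervalIntegral.integral_mono_on hππ ((hsI huc).add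
      (((hsI continuous_cos).const_mul _).add ((hsI continuous_sin).const_mul _)))
      (hI (by fun_prop) _ _) fun x _ => ?_
    have : s x * u x + ((a * cos t - b * sin t) * (s x * cos x) +
        (a * sin t + b * cos t) * (s x * sin x)) =
        s x * (u x + (a * cos (x - t) + b * sin (x - t))) := by
      rw [cos_sub, sin_sub]
      ring
    rw [this]
    by_cases hx : 0 < u x
    · simpa [hs, hx] using le_abs_self _
    · simp only [hs, hx, if_false, neg_one_mul]
      exact neg_le_abs _
  have hdU : ∀ t, HasDerivAt U (u (t + π) - u t) t := by
    intro t
    have h := fun x => (huc.integral_hasStrictDerivAt 0 x).hasDerivAt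
    refine (((h (t + π)).comp_add_const t π).sub (h t)).congr_of_eventuallyEq
      (Filter.Eventually.of_forall fun x => ?_)
    simp only [hU, Pi.sub_apply]
    rw [intervalIntegral.integral_interval_sub_left (hI huc _ _) (hI huc _ _)]
  have hUc : Continuous U := continuous_iff_continuousAt.2 fun x => (hdU x).continuousAt
  have hDcos : ∫ t in (-π)..π, (u (t + π) - u t) * cos t = 0 := by
    have h1 := hshiftπ (f := fun x => u x * cos x) fun x => by simp only [hper x, cos_add_two_pi]
    simp only [cos_add_pi, mul_neg, intervalIntegral.integral_neg, hcos] at h1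
    simp_rw [sub_mul]
    rw [intervalIntegral.integral_sub (hI (by fun_prop) _ _) (hI (by fun_prop) _ _), hcos]
    linarith
  have hDsin : ∫ t in (-π)..π, (u (t + π) - u t) * sin t = 0 := by
    have h1 := hshiftπ (f := fun x => u x * sin x) fun x => by simp only [hper x, sin_add_two_pi]
    simp only [sin_add_pi, mul_neg, intervalIntegral.integral_neg, hsin] at h1
    simp_rw [sub_mul]
    rw [intervalIntegral.integral_sub (hI (by fun_prop) _ _) (hI (by fun_prop) _ _), hsin]
    linarith
  have hUcos : ∫ t in (-π)..π, U t * cos t = 0 := by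
    have h := intervalIntegral.integral_eq_sub_of_hasDerivAt (a := -π) (b := π)
      (fun x _ => (hdU x).mul (hasDerivAt_sin x)) (hI (by fun_prop) _ _)
    rw [intervalIntegral.integral_add (hI (by fun_prop) _ _) (hI (by fun_prop) _ _), hDsin] at h
    simpa using h
  have hUsin : ∫ t in (-π)..π, U t * sin t = 0 := by
    have hUπ : U π = U (-π) := by
      simp only [hU]
      rw [show π + π = -π + π + 2 * π by ring]
      nth_rewrite 1 [show π = -π + 2 * π by ring]
      rw [← intervalIntegral.integral_comp_add_right]
      simp only [hper _]
    have h := intervalIntegral.integral_eq_sub_of_hasDerivAt (a := -π) (b := π)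
      (fun x _ => (hdU x).mul (hasDerivAt_cos x)) (hI (by fun_prop) _ _)
    rw [intervalIntegral.integral_add (hI (by fun_prop) _ _) (hI (by fun_prop) _ _), hDcos] at h
    simpa [hUπ] using h
  have havg : ∫ t in (-π)..π, (I + ((u (t + π) - u t) / 2 * (C * cos t + S * sin t) +
      -U t / 2 * (S * cos t - C * sin t))) = 2 * π * I := by
    have : ∀ t, I + ((u (t + π) - u t) / 2 * (C * cos t + S * sin t) +
      -U t / 2 * (S * cos t - C * sin t)) = I + (C / 2 * ((u (t + π) - u t) * cos t) +
        (S / 2 * ((u (t + π) - u t) * sin t) + (-S / 2 * (U t * cos t) +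
          C / 2 * (U t * sin t)))) := fun t => by ring
    simp_rw [this]
    rw [intervalIntegral.integral_add (hI (by fun_prop) _ _) (hI (by fun_prop) _ _),
      intervalIntegral.integral_add (hI (by fun_prop) _ _) (hI (by fun_prop) _ _),
      intervalIntegral.integral_add (hI (by fun_prop) _ _) (hI (by fun_prop) _ _),
      intervalIntegral.integral_add (hI (by fun_prop) _ _) (hI (by fun_prop) _ _)]
    simp only [intervalIntegral.integral_const_mul, hDcos, hDsin, hUcos, hUsin,
      intervalIntegral.integral_const, smul_eq_mul]
    ring
  have hbound := intervalIntegral.integral_mono_on hππ (hI (by fun_prop) _ _)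
    (hI continuous_const _ _) fun t (_ : t ∈ Set.Icc (-π) π) => hle t
  rw [havg] at hbound
  simp only [intervalIntegral.integral_const, smul_eq_mul] at hbound
  have hIK : I ≤ √(2 * (4 - π) * Q) := by
    nlinarith [pi_pos]
  have hI0 : 0 ≤ I := intervalIntegral.integral_nonneg hππ fun x _ => abs_nonneg _
  calc I ^ 2 ≤ √(2 * (4 - π) * Q) ^ 2 := by gcongr
    _ = 2 * (4 - π) * Q := sq_sqrt hQ0

/-- The odd function `c ↦ sign c * (√(1 + |c|) - 1)`, as a primitive of `1 / (2 * √(1 + |c|))`. -/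
noncomputable def extremalProfile (c : ℝ) : ℝ := ∫ x in 0..c, 1 / (2 * √(1 + |x|))

/-- The extremal function: `√2 * cos θ - 1` on `[-π/4, π/4]`, extended antiperiodically. -/
noncomputable def extremal (θ : ℝ) : ℝ := extremalProfile (cos (2 * θ))

theorem continuous_extremalProfile_deriv : Continuous fun x : ℝ => 1 / (2 * √(1 + |x|)) := by
  refine continuous_const.div (by fun_prop) fun x => ?_
  positivity

theorem hasDerivAt_extremalProfile (c : ℝ) :
    HasDerivAt extremalProfile (1 / (2 * √(1 + |c|))) c :=
  (continuous_extremalProfile_deriv.integral_hasStrictDerivAt 0 c).hasDerivAt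

theorem extremalProfile_neg (c : ℝ) : extremalProfile (-c) = -extremalProfile c := by
  have h := intervalIntegral.integral_comp_neg (a := 0) (b := c)
    (f := fun x => 1 / (2 * √(1 + |x|)))
  simp only [abs_neg, neg_zero] at h
  rw [extremalProfile, extremalProfile, intervalIntegral.integral_symm, h]

theorem extremalProfile_of_nonneg {c : ℝ} (hc : 0 ≤ c) : extremalProfile c = √(1 + c) - 1 := by
  have h : ∀ x ∈ Set.uIcc 0 c, HasDerivAt (fun x => √(1 + x)) (1 / (2 * √(1 + |x|))) x := by
    intro x hx
    rw [Set.uIcc_of_le hc] at hx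
    rw [abs_of_nonneg hx.1]
    exact ((hasDerivAt_id x).const_add 1).sqrt (by simp only [id]; linarith [hx.1])
  rw [extremalProfile, intervalIntegral.integral_eq_sub_of_hasDerivAt h
    (continuous_extremalProfile_deriv.intervalIntegrable _ _)]
  simp

theorem abs_extremalProfile (c : ℝ) : |extremalProfile c| = √(1 + |c|) - 1 := by
  have h : ∀ c : ℝ, 0 ≤ c → |extremalProfile c| = √(1 + |c|) - 1 := by
    intro c hc
    rw [extremalProfile_of_nonneg hc, abs_of_nonneg hc, abs_of_nonneg]
    exact sub_nonneg.2 (one_le_sqrt.2 (by linarith))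
  rcases le_total 0 c with hc | hc
  · exact h c hc
  · have := h (-c) (neg_nonneg.2 hc)
    rwa [extremalProfile_neg, abs_neg, abs_neg] at this

theorem hasDerivAt_extremal (θ : ℝ) :
    HasDerivAt extremal (-sin (2 * θ) / √(1 + |cos (2 * θ)|)) θ := by
  have h2 : HasDerivAt (fun θ : ℝ => 2 * θ) 2 θ := by
    simpa using (hasDerivAt_id θ).const_mul (2 : ℝ)
  refine ((hasDerivAt_extremalProfile (cos (2 * θ))).comp θ h2.cos).congr_deriv ?_
  have : √(1 + |cos (2 * θ)|) ≠ 0 := by positivity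
  field_simp

theorem deriv_extremal :
    deriv extremal = fun θ => -sin (2 * θ) / √(1 + |cos (2 * θ)|) :=
  funext fun θ => (hasDerivAt_extremal θ).deriv

theorem contDiff_extremal : ContDiff ℝ 1 extremal := by
  rw [contDiff_one_iff_deriv, deriv_extremal]
  refine ⟨fun θ => (hasDerivAt_extremal θ).differentiableAt, ?_⟩
  refine Continuous.div (by fun_prop) (by fun_prop) fun x => ?_
  positivity

theorem extremal_add_pi_div_two (θ : ℝ) : extremal (θ + π / 2) = -extremal θ := by
  rw [extremal, show 2 * (θ + π / 2) = 2 * θ + π by ring, cos_add_pi, extremalProfile_neg, extremal]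

theorem extremal_add_pi (θ : ℝ) : extremal (θ + π) = extremal θ := by
  rw [extremal, show 2 * (θ + π) = 2 * θ + 2 * π by ring, cos_add_two_pi, extremal]

theorem periodic_extremal : Function.Periodic extremal (2 * π) := fun θ => by
  rw [show θ + 2 * π = θ + π + π by ring, extremal_add_pi, extremal_add_pi]

theorem integral_eq_zero_of_antiperiodic {f : ℝ → ℝ} (hf : Function.Periodic f (2 * π)) {T : ℝ}
    (hT : ∀ x, f (x + T) = -f x) : ∫ x in (-π)..π, f x = 0 := by
  have h1 := intervalIntegral.integral_comp_add_right (a := -π) (b := π) f T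
  simp only [hT, intervalIntegral.integral_neg] at h1
  have h2 := hf.intervalIntegral_add_eq (-π) (-π + T)
  rw [show -π + 2 * π = π by ring, show -π + T + 2 * π = π + T by ring] at h2
  linarith

theorem integral_eq_four_mul_of_periodic {f : ℝ → ℝ} (hfc : Continuous f)
    (hf : Function.Periodic f (π / 2)) :
    ∫ x in (-π)..π, f x = 4 * ∫ x in (-(π / 4))..(π / 4), f x := by
  have h1 := hf.intervalIntegral_add_zsmul_eq 4 (-π) fun a b => hfc.intervalIntegrable a b
  have h2 := hf.intervalIntegral_add_eq (-π) (-(π / 4))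
  rw [h2] at h1
  rw [show -(π / 4) + π / 2 = π / 4 by ring] at h1
  simpa [show -π + 4 * (π / 2) = π by ring] using h1

theorem sqrt_one_add_abs_cos_two_mul {x : ℝ} (hx : x ∈ Set.uIcc (-(π / 4)) (π / 4)) :
    √(1 + |cos (2 * x)|) = √2 * cos x := by
  rw [Set.uIcc_of_le (by linarith [pi_pos])] at hx
  have h1 : 0 ≤ cos (2 * x) := cos_nonneg_of_mem_Icc ⟨by linarith [hx.1], by linarith [hx.2]⟩
  have h2 : 0 ≤ cos x :=
    cos_nonneg_of_mem_Icc ⟨by linarith [hx.1, pi_pos], by linarith [hx.2, pi_pos]⟩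
  rw [abs_of_nonneg h1, cos_two_mul, show 1 + (2 * cos x ^ 2 - 1) = 2 * cos x ^ 2 by ring,
    sqrt_mul (by norm_num), sqrt_sq h2]

theorem abs_cos_two_mul {x : ℝ} (hx : x ∈ Set.uIcc (-(π / 4)) (π / 4)) :
    |cos (2 * x)| = cos (2 * x) := by
  rw [Set.uIcc_of_le (by linarith [pi_pos])] at hx
  exact abs_of_nonneg (cos_nonneg_of_mem_Icc ⟨by linarith [hx.1], by linarith [hx.2]⟩)

theorem sqrt_two_mul_integral_cos : √2 * ∫ x in (-(π / 4))..(π / 4), cos x = 2 := by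
  rw [integral_cos, sin_neg, sin_pi_div_four]
  nlinarith [sq_sqrt (show (0 : ℝ) ≤ 2 by norm_num)]

theorem integral_abs_extremal : ∫ θ in (-π)..π, |extremal θ| = 2 * (4 - π) := by
  rw [integral_eq_four_mul_of_periodic contDiff_extremal.continuous.abs fun θ => by
    rw [extremal_add_pi_div_two, abs_neg]]
  have : ∫ x in (-(π / 4))..(π / 4), |extremal x| =
      ∫ x in (-(π / 4))..(π / 4), (√2 * cos x - 1) := by
    refine intervalIntegral.integral_congr fun x hx => ?_
    simp only [extremal, abs_extremalProfile, sqrt_one_add_abs_cos_two_mul hx]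
  rw [this, intervalIntegral.integral_sub (Continuous.intervalIntegrable (by fun_prop) _ _)
    (Continuous.intervalIntegrable (by fun_prop) _ _), intervalIntegral.integral_const_mul,
    sqrt_two_mul_integral_cos]
  simp
  ring

theorem deriv_extremal_sq_sub_extremal_sq (θ : ℝ) : deriv extremal θ ^ 2 - extremal θ ^ 2 =
    2 * √(1 + |cos (2 * θ)|) - 2 * |cos (2 * θ)| - 1 := by
  rw [deriv_extremal, extremal, ← sq_abs (extremalProfile _), abs_extremalProfile, div_pow, neg_sq]
  have hs : √(1 + |cos (2 * θ)|) ^ 2 = 1 + |cos (2 * θ)| := sq_sqrt (by positivity)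
  have h1 : sin (2 * θ) ^ 2 / (1 + |cos (2 * θ)|) = 1 - |cos (2 * θ)| := by
    rw [div_eq_iff (by positivity), sin_sq, ← sq_abs (cos (2 * θ))]
    ring
  rw [hs, h1]
  linear_combination -hs

theorem integral_deriv_extremal_sq_sub :
    ∫ θ in (-π)..π, (deriv extremal θ ^ 2 - extremal θ ^ 2) = 2 * (4 - π) := by
  simp_rw [deriv_extremal_sq_sub_extremal_sq]
  rw [integral_eq_four_mul_of_periodic (by fun_prop) fun θ => by
    rw [show 2 * (θ + π / 2) = 2 * θ + π by ring, cos_add_pi, abs_neg]]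
  have : ∫ x in (-(π / 4))..(π / 4), (2 * √(1 + |cos (2 * x)|) - 2 * |cos (2 * x)| - 1) =
      ∫ x in (-(π / 4))..(π / 4), (2 * (√2 * cos x) - 2 * cos (2 * x) - 1) := by
    refine intervalIntegral.integral_congr fun x hx => ?_
    simp only [sqrt_one_add_abs_cos_two_mul hx]
    rw [abs_cos_two_mul hx]
  have hI : ∀ {f : ℝ → ℝ}, Continuous f → IntervalIntegrable f volume (-(π / 4)) (π / 4) :=
    fun hf => hf.intervalIntegrable _ _
  have hcos : ∫ x in (-(π / 4))..(π / 4), cos (2 * x) = 1 := by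
    rw [intervalIntegral.integral_comp_mul_left _ (two_ne_zero), integral_cos,
      show 2 * (π / 4) = π / 2 by ring, show 2 * -(π / 4) = -(π / 2) by ring, sin_neg]
    simp
    norm_num
  rw [this, intervalIntegral.integral_sub (hI (by fun_prop)) (hI (by fun_prop)),
    intervalIntegral.integral_sub (hI (by fun_prop)) (hI (by fun_prop)),
    intervalIntegral.integral_const_mul, intervalIntegral.integral_const_mul,
    intervalIntegral.integral_const_mul, sqrt_two_mul_integral_cos, hcos]
  simp
  ring

theorem stmt_0 :
    sInf {r : ℝ | ∃ u : ℝ → ℝ, ContDiff ℝ 1 u ∧ Function.Periodic u (2 * π) ∧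
      (∫ θ in (-π)..π, u θ) = 0 ∧
      (∫ θ in (-π)..π, u θ * Real.cos θ) = 0 ∧
      (∫ θ in (-π)..π, u θ * Real.sin θ) = 0 ∧
      (∫ θ in (-π)..π, |u θ|) ≠ 0 ∧
      r = (∫ θ in (-π)..π, ((deriv u θ) ^ 2 - (u θ) ^ 2)) /
          (∫ θ in (-π)..π, |u θ|) ^ 2} = 1 / (2 * (4 - π)) := by
  have h4 : 0 < 4 - π := by linarith [pi_lt_four]
  refine IsLeast.csInf_eq ⟨⟨extremal, contDiff_extremal, periodic_extremal, ?_, ?_, ?_, ?_, ?_⟩, ?_⟩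
  · exact integral_eq_zero_of_antiperiodic periodic_extremal extremal_add_pi_div_two
  · refine integral_eq_zero_of_antiperiodic (T := π) (fun x => ?_) fun x => ?_
    · simp only [periodic_extremal x, cos_add_two_pi]
    · simp only [extremal_add_pi, cos_add_pi, mul_neg]
  · refine integral_eq_zero_of_antiperiodic (T := π) (fun x => ?_) fun x => ?_
    · simp only [periodic_extremal x, sin_add_two_pi]
    · simp only [extremal_add_pi, sin_add_pi, mul_neg]
  · rw [integral_abs_extremal]
    positivity
  · rw [integral_abs_extremal, integral_deriv_extremal_sq_sub]
    field_simp
  · rintro r ⟨u, hu, hper, hmean, hcos, hsin, hne, rfl⟩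
    have h := sq_integral_abs_le_of_period (u' := deriv u)
      (fun x => (hu.differentiable one_ne_zero x).hasDerivAt) (hu.continuous_deriv le_rfl)
      hper hmean hcos hsin
    rw [div_le_div_iff₀ (by positivity) (by positivity)]
    linarith
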